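/- Let u ∈ 𝒦, i.e. u is continuous and subharmonic in ℂ, positive and harmonic in ℂ∖E where E ⊂ (−∞,0] is closed and u vanishes on E, with every point of E regular for the Dirichlet problem. Then for all r > 0, θ ↦ u(re^{iθ}) is decreasing for 0 ≤ θ ≤ π; in particular B(r,u) = u(r) and A(r,u) = u(−r), where B(r,u) = max_{|z|=r} u(z) and A(r,u) = min_{|z|=r} u(z). -/

import Mathlib

open Filter Metric Real MeasureTheory

/-- The sub-mean-value property on circles; with continuity this expresses
that `u` is subharmonic in `ℂ`. -/
def Submean (u : ℂ → ℝ) : Prop :=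
  ∀ (z : ℂ) (ρ : ℝ), 0 < ρ →
    u z ≤ (1 / (2 * π)) * ∫ θ in (0:ℝ)..(2 * π), u (z + ρ * Complex.exp (θ * Complex.I))

/-- Mean-value equality on all circles whose closed discs lie in `D`; this expresses
that `u` is harmonic on `D`. -/
def HarmonicMeanOn (u : ℂ → ℝ) (D : Set ℂ) : Prop :=
  ∀ z ∈ D, ∀ ρ : ℝ, 0 < ρ → closedBall z ρ ⊆ D →
    u z = (1 / (2 * π)) * ∫ θ in (0:ℝ)..(2 * π), u (z + ρ * Complex.exp (θ * Complex.I))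

/-- `B(r,u) = max_{|z|=r} u(z)`. -/
noncomputable def Bmax (u : ℂ → ℝ) (r : ℝ) : ℝ := sSup (u '' sphere (0 : ℂ) r)

/-- `A(r,u) = min_{|z|=r} u(z)`. -/
noncomputable def Amin (u : ℂ → ℝ) (r : ℝ) : ℝ := sInf (u '' sphere (0 : ℂ) r)

/-- The class `𝒦`: `u` is continuous and subharmonic in `ℂ`, positive and harmonic
in `ℂ \ E`, where `E ⊆ (-∞, 0]` is a closed set on which `u` vanishes; `u` is
symmetric in the real axis. -/
structure ClassK (u : ℂ → ℝ) (E : Set ℂ) : Prop where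
  closed : IsClosed E
  subNegAxis : E ⊆ {z : ℂ | z.im = 0 ∧ z.re ≤ 0}
  cont : Continuous u
  submean : Submean u
  vanish : ∀ z ∈ E, u z = 0
  pos : ∀ z ∉ E, 0 < u z
  harm : HarmonicMeanOn u Eᶜ
  symm : ∀ z : ℂ, u ((starRingEnd ℂ) z) = u z

theorem circleAverage_comp_rotation (f : ℂ → ℝ) (β : ℝ) (z : ℂ) (ρ : ℝ) :
    circleAverage (fun w ↦ f (Complex.exp (β * Complex.I) * w)) z ρ
      = circleAverage f (Complex.exp (β * Complex.I) * z) ρ := by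
  rw [circleAverage_eq_integral_add (f := f) β, circleAverage_def]
  congr 2 with θ
  congr 1
  simp only [circleMap]
  rw [Complex.ofReal_add, add_mul, Complex.exp_add]
  ring

theorem circleAverage_re_cpow {a : ℝ} {z : ℂ} {ρ : ℝ} (hρ : 0 < ρ)
    (h : closedBall z ρ ⊆ Complex.slitPlane) :
    circleAverage (fun w ↦ (w ^ (a : ℂ)).re) z ρ = (z ^ (a : ℂ)).re := by
  have hd : ∀ w ∈ closedBall z ρ, DifferentiableAt ℂ (fun w : ℂ ↦ w ^ (a : ℂ)) w := fun w hw ↦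
    differentiableAt_id.cpow_const (h hw)
  have hc : ContinuousOn (fun w : ℂ ↦ w ^ (a : ℂ)) (closedBall z ρ) := fun w hw ↦
    (hd w hw).continuousAt.continuousWithinAt
  have h1 := Complex.reCLM.circleAverage_comp_comm
    ((hc.mono sphere_subset_closedBall).circleIntegrable hρ.le)
  rw [circleAverage_of_differentiable_on_off_countable Set.countable_empty
    (by rwa [abs_of_pos hρ]) (fun w hw ↦ hd w
      (ball_subset_closedBall (by simpa [abs_of_pos hρ] using hw)))] at h1
  exact h1

/-- A weak maximum principle for functions with the sub-mean-value property at points where they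
are positive. -/
theorem nonpos_of_le_circleAverage {K : Set ℂ} (hK : IsCompact K) {g : ℂ → ℝ}
    (hg : ContinuousOn g K)
    (h : ∀ z ∈ K, 0 < g z → ∃ ρ > 0, closedBall z ρ ⊆ K ∧ g z ≤ circleAverage g z ρ) :
    ∀ z ∈ K, g z ≤ 0 := by
  by_contra! hcon
  obtain ⟨w, hwK, hw⟩ := hcon
  obtain ⟨m, hmK, hm⟩ := hK.exists_isMaxOn ⟨w, hwK⟩ hg
  have hmpos : 0 < g m := hw.trans_le (hm hwK)
  have hS : IsCompact (K ∩ g ⁻¹' {g m}) :=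
    hK.of_isClosed_subset (hg.preimage_isClosed_of_isClosed hK.isClosed isClosed_singleton)
      Set.inter_subset_left
  obtain ⟨z, ⟨hzK, hz⟩, hzmax⟩ := hS.exists_isMaxOn ⟨m, hmK, rfl⟩ Complex.continuous_re.continuousOn
  have hz' : g z = g m := hz
  obtain ⟨ρ, hρ, hball, hsub⟩ := h z hzK (hz' ▸ hmpos)
  have hmem : ∀ θ, circleMap z ρ θ ∈ K := fun θ ↦
    hball (sphere_subset_closedBall (circleMap_mem_sphere z hρ.le θ))
  have hcont : ContinuousOn (fun θ ↦ g (circleMap z ρ θ)) (Set.Icc 0 (2 * π)) :=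
    hg.comp (continuous_circleMap z ρ).continuousOn fun θ _ ↦ hmem θ
  have hlt : g (circleMap z ρ 0) < g m := by
    refine lt_of_le_of_ne (hm (hmem 0)) fun heq ↦ ?_
    have h1 : (circleMap z ρ 0).re ≤ z.re := hzmax ⟨hmem 0, heq⟩
    simp [circleMap] at h1
    linarith
  have hint : ∫ θ in (0 : ℝ)..(2 * π), g (circleMap z ρ θ) < ∫ _ in (0 : ℝ)..(2 * π), g m :=
    intervalIntegral.integral_lt_integral_of_continuousOn_of_le_of_exists_lt two_pi_pos hcont
      continuousOn_const (fun θ _ ↦ hm (hmem θ)) ⟨0, ⟨le_rfl, two_pi_pos.le⟩, hlt⟩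
  rw [intervalIntegral.integral_const, smul_eq_mul, sub_zero] at hint
  rw [circleAverage_def, smul_eq_mul, hz', ← div_eq_inv_mul, le_div_iff₀ two_pi_pos] at hsub
  linarith

theorem integral_ball_eq_integral_circleAverage {u : ℂ → ℝ} (hu : Continuous u) (z : ℂ) (R : ℝ) :
    ∫ w in ball z R, u w = ∫ ρ in Set.Ioo 0 R, 2 * π * ρ * circleAverage u z ρ := by
  have hF : Continuous fun p : ℝ × ℝ ↦ p.1 * u (circleMap z p.1 p.2) := by fun_prop
  calc ∫ w in ball z R, u w
      = ∫ w, (ball (0 : ℂ) R).indicator (fun w ↦ u (w + z)) w := by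
        rw [← integral_indicator measurableSet_ball, ← integral_add_right_eq_self _ z]
        congr 1 with w
        simp [Set.indicator]
    _ = ∫ p in Set.Ioi (0 : ℝ) ×ˢ Set.Ioo (-π) π,
          (Set.Ioo 0 R ×ˢ Set.Ioo (-π) π).indicator
            (fun p : ℝ × ℝ ↦ p.1 * u (circleMap z p.1 p.2)) p := by
        rw [← Complex.integral_comp_polarCoord_symm]
        refine setIntegral_congr_fun (measurableSet_Ioi.prod measurableSet_Ioo) fun p hp ↦ ?_
        obtain ⟨hp1, hp2⟩ := hp
        have hp1' : 0 < p.1 := hp1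
        have e : Complex.polarCoord.symm p + z = circleMap z p.1 p.2 := by
          simp [circleMap, Complex.exp_mul_I, add_comm]
        have hn : ‖Complex.polarCoord.symm p‖ = p.1 := by
          rw [Complex.norm_polarCoord_symm, abs_of_pos hp1']
        simp only [Set.indicator, mem_ball_zero_iff, hn, e, Set.mem_prod, Set.mem_Ioo, smul_eq_mul]
        simp only [hp1', hp2.1, hp2.2, true_and, and_true]
        split_ifs <;> simp
    _ = ∫ p in Set.Ioo 0 R ×ˢ Set.Ioo (-π) π, p.1 * u (circleMap z p.1 p.2) := by
        rw [setIntegral_indicator (measurableSet_Ioo.prod measurableSet_Ioo)]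
        congr 2
        ext p
        simp only [Set.mem_inter_iff, Set.mem_prod, Set.mem_Ioi, Set.mem_Ioo]
        tauto
    _ = ∫ ρ in Set.Ioo 0 R, ∫ θ in Set.Ioo (-π) π, ρ * u (circleMap z ρ θ) := by
        rw [Measure.volume_eq_prod, setIntegral_prod]
        exact (hF.continuousOn.integrableOn_compact
          (isCompact_Icc.prod isCompact_Icc)).mono_set
            (Set.prod_mono Set.Ioo_subset_Icc_self Set.Ioo_subset_Icc_self)
    _ = ∫ ρ in Set.Ioo 0 R, 2 * π * ρ * circleAverage u z ρ := by
        congr 1 with ρ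
        have hper : Function.Periodic (fun θ ↦ u (circleMap z ρ θ)) (2 * π) := fun θ ↦ by
          simp [periodic_circleMap z ρ θ]
        have h := hper.intervalIntegral_add_eq (-π) 0
        rw [zero_add, show -π + 2 * π = π by ring] at h
        rw [integral_const_mul, ← integral_Ioc_eq_integral_Ioo,
          ← intervalIntegral.integral_of_le (by linarith [pi_pos]), h, circleAverage_def,
          smul_eq_mul]
        field_simp

theorem setIntegral_Ioo_two_pi_mul {R : ℝ} (hR : 0 ≤ R) (a : ℝ) :
    ∫ ρ in Set.Ioo 0 R, 2 * π * ρ * a = π * R ^ 2 * a := by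
  rw [← integral_Ioc_eq_integral_Ioo, ← intervalIntegral.integral_of_le hR,
    intervalIntegral.integral_mul_const, intervalIntegral.integral_const_mul, integral_id]
  ring

namespace ClassK

variable {u : ℂ → ℝ} {E : Set ℂ}

theorem nonneg (hK : ClassK u E) (z : ℂ) : 0 ≤ u z := by
  by_cases hz : z ∈ E
  · exact (hK.vanish z hz).ge
  · exact (hK.pos z hz).le

theorem le_circleAverage (hK : ClassK u E) (z : ℂ) {ρ : ℝ} (hρ : 0 < ρ) :
    u z ≤ circleAverage u z ρ := by
  simpa [circleAverage_def, circleMap] using hK.submean z ρ hρ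

theorem circleAverage_eq (hK : ClassK u E) {z : ℂ} {ρ : ℝ} (hρ : 0 < ρ)
    (h : closedBall z ρ ⊆ Eᶜ) : circleAverage u z ρ = u z := by
  simpa [circleAverage_def, circleMap] using
    (hK.harm z (h (mem_closedBall_self hρ.le)) ρ hρ h).symm

theorem le_integral_ball (hK : ClassK u E) (z : ℂ) {R : ℝ} (hR : 0 ≤ R) :
    π * R ^ 2 * u z ≤ ∫ w in ball z R, u w := by
  rw [integral_ball_eq_integral_circleAverage hK.cont, ← setIntegral_Ioo_two_pi_mul hR]
  have hc : Continuous fun ρ ↦ 2 * π * ρ * circleAverage u z ρ :=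
    (by fun_prop : Continuous fun ρ : ℝ ↦ 2 * π * ρ).mul hK.cont.circleAverage
  refine setIntegral_mono_on ?_ ?_ measurableSet_Ioo fun ρ hρ ↦ ?_
  · exact (Continuous.integrableOn_Icc (by fun_prop)).mono_set Set.Ioo_subset_Icc_self
  · exact hc.integrableOn_Icc.mono_set Set.Ioo_subset_Icc_self
  · have := hρ.1
    exact mul_le_mul_of_nonneg_left (hK.le_circleAverage z hρ.1) (by positivity)

theorem integral_ball_eq (hK : ClassK u E) {z : ℂ} {R : ℝ} (hR : 0 ≤ R) (h : ball z R ⊆ Eᶜ) :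
    ∫ w in ball z R, u w = π * R ^ 2 * u z := by
  rw [integral_ball_eq_integral_circleAverage hK.cont, ← setIntegral_Ioo_two_pi_mul hR]
  refine setIntegral_congr_fun measurableSet_Ioo fun ρ hρ ↦ ?_
  rw [hK.circleAverage_eq hρ.1 ((closedBall_subset_ball hρ.2).trans h)]

theorem integrableOn_ball (hK : ClassK u E) (z : ℂ) (R : ℝ) : IntegrableOn u (ball z R) :=
  (hK.cont.continuousOn.integrableOn_compact (isCompact_closedBall z R)).mono_set
    ball_subset_closedBall

/-- A Harnack-type inequality. -/
theorem harnack (hK : ClassK u E) {z w : ℂ} {ρ R : ℝ} (hρ : 0 ≤ ρ)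
    (hw : dist w z + ρ ≤ R) (h : ball z R ⊆ Eᶜ) : ρ ^ 2 * u w ≤ R ^ 2 * u z := by
  have hsub : ball w ρ ⊆ ball z R := ball_subset_ball' (by linarith)
  have h1 : π * ρ ^ 2 * u w ≤ π * R ^ 2 * u z := by
    rw [← hK.integral_ball_eq (by linarith [dist_nonneg (x := w) (y := z)]) h]
    exact (hK.le_integral_ball w hρ).trans (setIntegral_mono_set (hK.integrableOn_ball z R)
      (.of_forall hK.nonneg) hsub.eventuallyLE)
  rw [mul_assoc, mul_assoc] at h1
  exact le_of_mul_le_mul_left h1 pi_pos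

theorem mem_compl_of_mem_slitPlane (hK : ClassK u E) {z : ℂ} (hz : z ∈ Complex.slitPlane) :
    z ∈ Eᶜ := by
  intro h
  obtain ⟨him, hre⟩ := hK.subNegAxis h
  rcases Complex.mem_slitPlane_iff.1 hz with h' | h'
  · linarith
  · exact h' him

theorem ball_subset_compl_of_le_abs_im (hK : ClassK u E) {z : ℂ} {R : ℝ} (hR : R ≤ |z.im|) :
    ball z R ⊆ Eᶜ := by
  intro w hw hwE
  have him : w.im = 0 := (hK.subNegAxis hwE).1
  have h1 : |(w - z).im| ≤ ‖w - z‖ := Complex.abs_im_le_norm _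
  rw [mem_ball, dist_eq_norm] at hw
  rw [Complex.sub_im, him, zero_sub, abs_neg] at h1
  linarith

theorem ball_subset_compl_of_re_nonneg (hK : ClassK u E) {z : ℂ} {R : ℝ} (hz : 0 ≤ z.re)
    (hR : R ≤ ‖z‖) : ball z R ⊆ Eᶜ := by
  intro w hw hwE
  obtain ⟨him, hre⟩ := hK.subNegAxis hwE
  rw [mem_ball, dist_eq_norm] at hw
  have h1 : ‖z‖ ^ 2 ≤ ‖w - z‖ ^ 2 := by
    rw [← Complex.normSq_eq_norm_sq, ← Complex.normSq_eq_norm_sq, Complex.normSq_apply,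
      Complex.normSq_apply, Complex.sub_re, Complex.sub_im, him]
    nlinarith
  linarith [(pow_le_pow_iff_left₀ (norm_nonneg z) (norm_nonneg (w - z)) two_ne_zero).1 h1]

theorem im_sq_mul_le (hK : ClassK u E) {r : ℝ} (hr : 0 < r) {z : ℂ} (hre : |z.re| ≤ 2 * r)
    (him : |z.im| ≤ 4 * r) : z.im ^ 2 * u z ≤ 64 * r ^ 2 * u ⟨0, 4 * r⟩ := by
  have key : ∀ z : ℂ, |z.re| ≤ 2 * r → 0 ≤ z.im → z.im ≤ 4 * r →
      z.im ^ 2 * u z ≤ 64 * r ^ 2 * u ⟨0, 4 * r⟩ := by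
    intro z hre h0 him
    have h1 : z.im ^ 2 * u z ≤ (4 * r) ^ 2 * u ⟨z.re, 4 * r⟩ := by
      refine hK.harnack h0 ?_ (hK.ball_subset_compl_of_le_abs_im (le_abs_self _))
      have hd : dist z ⟨z.re, 4 * r⟩ = dist z.im (4 * r) := Complex.dist_of_re_eq rfl
      rw [hd, Real.dist_eq, abs_of_nonpos (by linarith)]
      linarith
    have h2 : (2 * r) ^ 2 * u ⟨z.re, 4 * r⟩ ≤ (4 * r) ^ 2 * u ⟨0, 4 * r⟩ := by
      refine hK.harnack (by linarith) ?_ (hK.ball_subset_compl_of_le_abs_im (le_abs_self _))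
      have hd : dist (⟨z.re, 4 * r⟩ : ℂ) ⟨0, 4 * r⟩ = dist z.re 0 := Complex.dist_of_im_eq rfl
      rw [hd, Real.dist_eq, sub_zero]
      linarith
    nlinarith
  rcases le_total 0 z.im with h | h
  · exact key z hre h ((le_abs_self _).trans him)
  · have := key ((starRingEnd ℂ) z) (by simpa using hre) (by simpa using h)
      (by simpa using (neg_le_abs _).trans him)
    simpa [hK.symm] using this

/-- A subharmonic function with at most power growth towards the real axis is bounded near it. -/
theorem le_mul_apply_imaginary (hK : ClassK u E) {r : ℝ} (hr : 0 < r) {z : ℂ} (hz : ‖z‖ ≤ r) :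
    u z ≤ 131072 * u ⟨0, 4 * r⟩ := by
  set U := u ⟨0, 4 * r⟩
  have hU : 0 ≤ U := hK.nonneg _
  have hcont : ContinuousOn (fun z ↦ u z * (2 * r - ‖z‖) ^ 2) (closedBall 0 (2 * r)) := by
    have := hK.cont
    fun_prop
  obtain ⟨m, hmem, hmax⟩ := (isCompact_closedBall (0 : ℂ) (2 * r)).exists_isMaxOn
    ⟨0, by simp [hr.le]⟩ hcont
  rw [mem_closedBall_zero_iff] at hmem
  set A := u m
  set d := 2 * r - ‖m‖
  have hA : 0 ≤ A := hK.nonneg _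
  have hd : 0 ≤ d := sub_nonneg.2 hmem
  suffices hAd : A * d ^ 2 ≤ 131072 * r ^ 2 * U by
    have h1 : u z * (2 * r - ‖z‖) ^ 2 ≤ A * d ^ 2 :=
      hmax (mem_closedBall_zero_iff.2 (by linarith))
    have h2 : u z * r ^ 2 ≤ u z * (2 * r - ‖z‖) ^ 2 :=
      mul_le_mul_of_nonneg_left (pow_le_pow_left₀ hr.le (by linarith) 2) (hK.nonneg z)
    have h3 : r ^ 2 * u z ≤ r ^ 2 * (131072 * U) := by linarith
    exact le_of_mul_le_mul_left h3 (by positivity)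
  rcases hd.eq_or_lt with hd0 | hdpos
  · rw [← hd0]
    have : 0 ≤ 131072 * r ^ 2 * U := by positivity
    simpa using this
  set ρ := d / 2 with hρ
  have hρpos : 0 < ρ := by positivity
  set δ := ρ / 16 with hδ
  have hδpos : 0 < δ := by positivity
  set S : Set ℂ := Set.Icc (m.re - ρ) (m.re + ρ) ×ℂ Set.Icc (-δ) δ
  have hSmeas : MeasurableSet S :=
    (measurableSet_Icc.preimage Complex.measurable_re).inter
      (measurableSet_Icc.preimage Complex.measurable_im)
  have hSvol : volume S = ENNReal.ofReal (4 * ρ * δ) := by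
    have e : S = Complex.measurableEquivRealProd ⁻¹'
        (Set.Icc (m.re - ρ) (m.re + ρ) ×ˢ Set.Icc (-δ) δ) := by
      ext w
      rfl
    rw [e, Complex.volume_preserving_equiv_real_prod.measure_preimage_equiv,
      Measure.volume_eq_prod, Measure.prod_prod, Real.volume_Icc, Real.volume_Icc,
      ← ENNReal.ofReal_mul (by linarith)]
    congr 1
    ring
  have hbound : ∀ w ∈ ball m ρ, u w ≤ 64 * r ^ 2 * U / δ ^ 2 + S.indicator (fun _ ↦ 4 * A) w := by
    intro w hw
    rw [mem_ball, dist_eq_norm] at hw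
    have hnw : ‖w‖ ≤ ‖m‖ + ρ := by
      have := norm_le_norm_add_norm_sub m w
      rw [norm_sub_rev] at this
      linarith
    have hw2 : ‖w‖ ≤ 2 * r := by simp only [d, ρ] at *; linarith
    by_cases hwS : |w.im| ≤ δ
    · have hmemS : w ∈ S := by
        have h1 := abs_le.1 ((Complex.abs_re_le_norm (w - m)).trans hw.le)
        rw [Complex.sub_re] at h1
        exact ⟨⟨by linarith, by linarith⟩, abs_le.1 hwS⟩
      rw [Set.indicator_of_mem hmemS]
      have h1 : u w * (2 * r - ‖w‖) ^ 2 ≤ A * d ^ 2 := hmax (mem_closedBall_zero_iff.2 hw2)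
      have h2 : u w * ρ ^ 2 ≤ u w * (2 * r - ‖w‖) ^ 2 :=
        mul_le_mul_of_nonneg_left
          (pow_le_pow_left₀ hρpos.le (by simp only [d, ρ] at *; linarith) 2) (hK.nonneg w)
      have h3 : ρ ^ 2 * u w ≤ ρ ^ 2 * (4 * A) := by
        have : d = 2 * ρ := by rw [hρ]; ring
        rw [this] at h1
        nlinarith
      have h4 := le_of_mul_le_mul_left h3 (by positivity)
      have h5 : 0 ≤ 64 * r ^ 2 * U / δ ^ 2 := by positivity
      linarith
    · push Not at hwS
      have h1 := hK.im_sq_mul_le hr ((Complex.abs_re_le_norm w).trans hw2)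
        ((Complex.abs_im_le_norm w).trans (by linarith))
      have h2 : u w ≤ 64 * r ^ 2 * U / δ ^ 2 := by
        rw [le_div_iff₀ (by positivity)]
        have h3 : δ ^ 2 ≤ w.im ^ 2 := by
          rw [← sq_abs w.im]
          exact pow_le_pow_left₀ hδpos.le hwS.le 2
        nlinarith [mul_le_mul_of_nonneg_left h3 (hK.nonneg w)]
      have h3 : 0 ≤ S.indicator (fun _ ↦ 4 * A) w :=
        Set.indicator_nonneg (fun _ _ ↦ by positivity) w
      linarith
  have hSfin : volume S ≠ ⊤ := by rw [hSvol]; exact ENNReal.ofReal_ne_top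
  have hindInt : Integrable (S.indicator fun _ ↦ 4 * A) :=
    (integrable_indicator_iff hSmeas).2 (integrableOn_const hSfin)
  have hconst : IntegrableOn (fun _ : ℂ ↦ 64 * r ^ 2 * U / δ ^ 2) (ball m ρ) :=
    integrableOn_const measure_ball_lt_top.ne
  have hball : volume.real (ball m ρ) = π * ρ ^ 2 := by
    simp [Measure.real, Complex.volume_ball, hρpos.le, mul_comm]
  have hI : π * ρ ^ 2 * A ≤ π * ρ ^ 2 * (64 * r ^ 2 * U / δ ^ 2) + 4 * ρ * δ * (4 * A) := calc
    π * ρ ^ 2 * A ≤ ∫ w in ball m ρ, u w := hK.le_integral_ball m hρpos.le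
    _ ≤ ∫ w in ball m ρ, (64 * r ^ 2 * U / δ ^ 2 + S.indicator (fun _ ↦ 4 * A) w) :=
      setIntegral_mono_on (hK.integrableOn_ball m ρ) (hconst.add hindInt.integrableOn)
        measurableSet_ball hbound
    _ = π * ρ ^ 2 * (64 * r ^ 2 * U / δ ^ 2) + ∫ w in ball m ρ, S.indicator (fun _ ↦ 4 * A) w := by
      rw [integral_add hconst hindInt.integrableOn, setIntegral_const, hball, smul_eq_mul]
    _ ≤ π * ρ ^ 2 * (64 * r ^ 2 * U / δ ^ 2) + ∫ w, S.indicator (fun _ ↦ 4 * A) w :=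
      add_le_add le_rfl (setIntegral_le_integral hindInt
        (.of_forall fun w ↦ Set.indicator_nonneg (fun _ _ ↦ by positivity) w))
    _ = _ := by
      rw [integral_indicator hSmeas, setIntegral_const, Measure.real, hSvol,
        ENNReal.toReal_ofReal (by positivity), smul_eq_mul]
  have e1 : π * ρ ^ 2 * (64 * r ^ 2 * U / δ ^ 2) = π * (16384 * r ^ 2 * U) := by
    rw [hδ]
    field_simp
    ring
  have e2 : 4 * ρ * δ * (4 * A) = ρ ^ 2 * A := by
    rw [hδ]
    ring
  rw [e1, e2] at hI
  have hd2 : d ^ 2 = 4 * ρ ^ 2 := by rw [hρ]; ring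
  rw [hd2]
  have h3 : 0 ≤ ρ ^ 2 * A := by positivity
  have h4 : π * (ρ ^ 2 * A) ≤ π * (32768 * r ^ 2 * U) := by
    nlinarith [pi_gt_three, mul_le_mul_of_nonneg_right pi_gt_three.le h3]
  have h5 := le_of_mul_le_mul_left h4 pi_pos
  linarith

/-- Points of a circle away from the negative axis dominate a fixed point. -/
theorem apply_imaginary_le_mul (hK : ClassK u E) {r : ℝ} (hr : 0 < r) {z : ℂ} (hz : ‖z‖ = 10 * r)
    (hre : -(2 * r) ≤ z.re) : u ⟨0, 4 * r⟩ ≤ 2500 * u z := by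
  have hc : r ^ 2 * u ⟨0, 4 * r⟩ ≤ (5 * r) ^ 2 * u ⟨3 * r, 4 * r⟩ := by
    refine hK.harnack hr.le ?_ (hK.ball_subset_compl_of_re_nonneg (by simp [hr.le]) ?_)
    · have hd : dist (⟨0, 4 * r⟩ : ℂ) ⟨3 * r, 4 * r⟩ = dist 0 (3 * r) := Complex.dist_of_im_eq rfl
      rw [hd, Real.dist_eq, abs_of_nonpos (by linarith)]
      linarith
    · refine le_of_eq ?_
      rw [Complex.norm_def, Complex.normSq_mk,
        show 3 * r * (3 * r) + 4 * r * (4 * r) = (5 * r) ^ 2 by ring, Real.sqrt_sq (by linarith)]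
  have key : ∀ z : ℂ, ‖z‖ = 10 * r → -(2 * r) ≤ z.re → 0 ≤ z.im →
      r ^ 2 * u ⟨3 * r, 4 * r⟩ ≤ (95 / 10 * r) ^ 2 * u z := by
    intro z hz hre him
    have hsq : z.re ^ 2 + z.im ^ 2 = (10 * r) ^ 2 := by
      rw [← hz, ← Complex.normSq_eq_norm_sq, Complex.normSq_apply]
      ring
    have hball : ball z (95 / 10 * r) ⊆ Eᶜ := by
      rcases le_total 0 z.re with h | h
      · exact hK.ball_subset_compl_of_re_nonneg h (by linarith)
      · refine hK.ball_subset_compl_of_le_abs_im ?_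
        rw [abs_of_nonneg him]
        nlinarith
    refine hK.harnack hr.le ?_ hball
    have hd : dist (⟨3 * r, 4 * r⟩ : ℂ) z ≤ 85 / 10 * r := by
      rw [Complex.dist_eq_re_im]
      refine Real.sqrt_le_iff.2 ⟨by linarith, ?_⟩
      simp only
      have h1 : 55 * r ≤ 6 * z.re + 8 * z.im := by
        rcases le_total 0 z.re with h | h
        · have : 10 * r ≤ z.re + z.im := by nlinarith
          linarith
        · have : 9 * r ≤ z.im := by nlinarith
          nlinarith
      nlinarith [mul_le_mul_of_nonneg_right h1 hr.le]
    linarith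
  have hz' : r ^ 2 * u ⟨3 * r, 4 * r⟩ ≤ (95 / 10 * r) ^ 2 * u z := by
    rcases le_total 0 z.im with h | h
    · exact key z hz hre h
    · simpa [hK.symm] using
        key ((starRingEnd ℂ) z) (by simpa using hz) (by simpa using hre) (by simpa using h)
  have h0 := hK.nonneg z
  have h1 : r ^ 2 * u ⟨0, 4 * r⟩ ≤ r ^ 2 * (2500 * u z) := by
    nlinarith [mul_nonneg (sq_nonneg r) h0]
  exact le_of_mul_le_mul_left h1 (by positivity)

theorem exists_le_mul_norm_rpow (hK : ClassK u E) :
    ∃ C : ℝ, 0 ≤ C ∧ ∀ z : ℂ, 1 ≤ ‖z‖ → u z ≤ C * ‖z‖ ^ (9 / 10 : ℝ) := by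
  refine ⟨131072 * 2500 * 10 ^ (9 / 10 : ℝ) * u 1, ?_, fun z hz ↦ ?_⟩
  · have := hK.nonneg 1
    positivity
  set r := ‖z‖
  have hr : 0 < r := by linarith
  set U := u ⟨0, 4 * r⟩
  have hU : 0 ≤ U := hK.nonneg _
  set κ := U / (2500 * (10 * r) ^ (9 / 10 : ℝ)) with hκ
  have hκ0 : 0 ≤ κ := by positivity
  set K : Set ℂ := closedBall 0 (10 * r) ∩ {w | -w.re ≤ ‖w‖ / 5}
  have hKc : IsCompact K := (isCompact_closedBall _ _).inter_right
    (isClosed_le (by fun_prop) (by fun_prop))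
  have hslit : ∀ w : ℂ, w ≠ 0 → -w.re ≤ ‖w‖ / 5 → w ∈ Complex.slitPlane := by
    intro w hw0 hw
    rw [Complex.mem_slitPlane_iff]
    by_contra! hcon
    have h1 : ‖w‖ = -w.re := by
      rw [Complex.norm_eq_sqrt_sq_add_sq, hcon.2]
      simp [Real.sqrt_sq_eq_abs, abs_of_nonpos hcon.1]
    have h2 : 0 < ‖w‖ := norm_pos_iff.2 hw0
    linarith
  have hcpow : ContinuousOn (fun w : ℂ ↦ (w ^ ((9 / 10 : ℝ) : ℂ)).re) K := by
    intro w hw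
    refine (Complex.continuous_re.continuousAt.comp
      (Complex.continuousAt_cpow_const_of_re_pos ?_ (by norm_num))).continuousWithinAt
    by_cases hw0 : w = 0
    · simp [hw0]
    · exact (Complex.mem_slitPlane_iff.1 (hslit w hw0 hw.2)).imp le_of_lt id
  have hcont : ContinuousOn (fun w : ℂ ↦ κ * (w ^ ((9 / 10 : ℝ) : ℂ)).re - u w) K :=
    (continuousOn_const.mul hcpow).sub hK.cont.continuousOn
  have hmain := nonpos_of_le_circleAverage hKc hcont ?_
  · have h1K : (1 : ℂ) ∈ K := by
      refine ⟨?_, ?_⟩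
      · simp only [mem_closedBall_zero_iff, norm_one]
        linarith
      · simp only [Set.mem_ofPred_eq, Complex.one_re, norm_one]
        norm_num
    have h1 := hmain 1 h1K
    simp only [Complex.one_cpow, Complex.one_re, mul_one, sub_nonpos] at h1
    rw [hκ, div_le_iff₀ (by positivity), Real.mul_rpow (by norm_num) hr.le] at h1
    have h2 : u z ≤ 131072 * U := hK.le_mul_apply_imaginary hr le_rfl
    linarith
  · intro w hw hpos
    have hu : 0 ≤ u w := hK.nonneg w
    have hre : 0 < (w ^ ((9 / 10 : ℝ) : ℂ)).re := by
      by_contra! h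
      nlinarith [mul_nonpos_of_nonneg_of_nonpos hκ0 h]
    have hw0 : w ≠ 0 := by
      rintro rfl
      simp [Complex.zero_cpow] at hre
    have hwn : 0 < ‖w‖ := norm_pos_iff.2 hw0
    have hside : -w.re < ‖w‖ / 5 := by
      refine lt_of_le_of_ne hw.2 fun heq ↦ ?_
      rw [Complex.cpow_ofReal_re] at hre
      have hcos : Real.cos |w.arg| = -(1 / 5) := by
        rw [Real.cos_abs, Complex.cos_arg hw0, div_eq_iff hwn.ne']
        linarith
      have harg : 5 * π / 9 ≤ |w.arg| := by
        by_contra! hlt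
        have h1 : Real.cos (5 * π / 9) < Real.cos |w.arg| :=
          Real.cos_lt_cos_of_nonneg_of_le_pi (abs_nonneg _) (by linarith [pi_pos]) hlt
        have h2 : Real.cos (5 * π / 9) = -Real.sin (π / 18) := by
          rw [← Real.cos_add_pi_div_two]
          congr 1
          ring
        have h3 : Real.sin (π / 18) ≤ π / 18 := Real.sin_le (by linarith [pi_pos])
        have h4 := Real.pi_lt_d2
        linarith
      have h5 : Real.cos (w.arg * (9 / 10)) ≤ 0 := by
        rw [← Real.cos_abs, abs_mul, abs_of_pos (by norm_num : (0 : ℝ) < 9 / 10)]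
        exact Real.cos_nonpos_of_pi_div_two_le_of_le (by linarith)
          (by linarith [Complex.abs_arg_le_pi w, pi_pos])
      exact absurd hre (not_lt.2 (mul_nonpos_of_nonneg_of_nonpos (by positivity) h5))
    have harc : ‖w‖ < 10 * r := by
      refine lt_of_le_of_ne (mem_closedBall_zero_iff.1 hw.1) fun heq ↦ ?_
      have h1 : U ≤ 2500 * u w := hK.apply_imaginary_le_mul hr heq (by linarith)
      have h2 : (w ^ ((9 / 10 : ℝ) : ℂ)).re ≤ (10 * r) ^ (9 / 10 : ℝ) := by
        rw [← heq, ← Complex.norm_cpow_real]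
        exact Complex.re_le_norm _
      have h3 := mul_le_mul_of_nonneg_left h2 hκ0
      have h4 : κ * (10 * r) ^ (9 / 10 : ℝ) = U / 2500 := by
        rw [hκ]
        field_simp
      linarith
    have hopen : IsOpen (ball (0 : ℂ) (10 * r) ∩ {w | -w.re < ‖w‖ / 5} ∩ {0}ᶜ) :=
      (isOpen_ball.inter (isOpen_lt (by fun_prop) (by fun_prop))).inter isOpen_compl_singleton
    obtain ⟨ρ, hρ, hball⟩ := nhds_basis_closedBall.mem_iff.1
      (hopen.mem_nhds ⟨⟨mem_ball_zero_iff.2 harc, hside⟩, hw0⟩)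
    have hballK : closedBall w ρ ⊆ K := fun x hx ↦
      ⟨ball_subset_closedBall (hball hx).1.1, le_of_lt (a := -x.re) (hball hx).1.2⟩
    have hballs : closedBall w ρ ⊆ Complex.slitPlane := fun x hx ↦
      hslit x (hball hx).2 (hball hx).1.2.le
    refine ⟨ρ, hρ, hballK, le_of_eq ?_⟩
    have hint : CircleIntegrable (fun w : ℂ ↦ κ * (w ^ ((9 / 10 : ℝ) : ℂ)).re) w ρ :=
      (continuousOn_const.mul (hcpow.mono
        (sphere_subset_closedBall.trans hballK))).circleIntegrable hρ.le
    rw [circleAverage_fun_sub hint (hK.cont.continuousOn.circleIntegrable hρ.le),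
      hK.circleAverage_eq hρ fun x hx ↦ hK.mem_compl_of_mem_slitPlane (hballs hx)]
    congr 1
    have := circleAverage_fun_smul (a := κ) (f := fun w : ℂ ↦ (w ^ ((9 / 10 : ℝ) : ℂ)).re)
      (c := w) (R := ρ)
    simp only [smul_eq_mul] at this
    rw [this, circleAverage_re_cpow hρ hballs]

/-- Polarisation with respect to the line through the origin with direction `exp (α * I)`. -/
theorem rotation_le_rotation (hK : ClassK u E) {α : ℝ} (hα0 : 0 ≤ α) (hαπ : α ≤ π) {ζ : ℂ}
    (hζ : ζ.im ≤ 0) :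
    u (Complex.exp (↑(-α) * Complex.I) * ζ) ≤ u (Complex.exp (α * Complex.I) * ζ) := by
  obtain ⟨C, hC, hgrowth⟩ := hK.exists_le_mul_norm_rpow
  have hnorm : ∀ (β : ℝ) (w : ℂ), ‖Complex.exp (β * Complex.I) * w‖ = ‖w‖ := fun β w ↦ by
    rw [norm_mul, Complex.norm_exp_ofReal_mul_I, one_mul]
  have hIre : ∀ w : ℂ, (Complex.exp (↑(π / 2) * Complex.I) * w).re = -w.im := fun w ↦ by
    simp [Complex.exp_pi_div_two_mul_I]
  set b : ℝ := 19 / 20 with hb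
  set H : ℂ → ℝ := fun w ↦ ((Complex.exp (↑(π / 2) * Complex.I) * w) ^ (b : ℂ)).re with hH
  have hcb : 0 < Real.cos (π / 2 * b) :=
    Real.cos_pos_of_mem_Ioo ⟨by linarith [pi_pos], by linarith [pi_pos]⟩
  have hHge : ∀ w : ℂ, w.im ≤ 0 → Real.cos (π / 2 * b) * ‖w‖ ^ b ≤ H w := by
    intro w hw
    have harg := Complex.abs_arg_le_pi_div_two_iff.2 (by rw [hIre]; linarith :
      0 ≤ (Complex.exp (↑(π / 2) * Complex.I) * w).re)
    simp only [hH]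
    rw [Complex.cpow_ofReal_re, hnorm, mul_comm]
    refine mul_le_mul_of_nonneg_left ?_ (by positivity)
    rw [← Real.cos_abs (Complex.arg _ * b), abs_mul, abs_of_pos (by norm_num : 0 < b)]
    refine Real.cos_le_cos_of_nonneg_of_le_pi (by positivity) ?_ ?_
    · linarith [pi_pos]
    · exact mul_le_mul_of_nonneg_right harg (by norm_num)
  have hH0 : ∀ w : ℂ, w.im ≤ 0 → 0 ≤ H w := fun w hw ↦ le_trans (by positivity) (hHge w hw)
  have hHcont : ContinuousOn H {w | w.im ≤ 0} := by
    intro w hw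
    refine ContinuousAt.continuousWithinAt ?_
    refine Complex.continuous_re.continuousAt.comp
      (ContinuousAt.comp (g := fun x : ℂ ↦ x ^ (b : ℂ))
        (Complex.continuousAt_cpow_const_of_re_pos (.inl ?_) ?_) (by fun_prop))
    · rw [hIre]
      have : w.im ≤ 0 := hw
      linarith
    · simp [hb]
  set G : ℂ → ℝ := fun w ↦
    u (Complex.exp (↑(-α) * Complex.I) * w) - u (Complex.exp (α * Complex.I) * w) with hG
  have hcu : ∀ β : ℝ, Continuous fun w ↦ u (Complex.exp (β * Complex.I) * w) := fun β ↦
    hK.cont.comp (by fun_prop)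
  have hGcont : Continuous G := (hcu (-α)).sub (hcu α)
  have hreal : ∀ w : ℂ, w.im = 0 → G w = 0 := by
    intro w hw
    have e : Complex.exp (↑(-α) * Complex.I) * w
        = (starRingEnd ℂ) (Complex.exp (α * Complex.I) * w) := by
      rw [map_mul, Complex.conj_eq_iff_im.2 hw, ← Complex.exp_conj]
      simp
    simp only [hG]
    rw [e, hK.symm, sub_self]
  have hcompl : ∀ w : ℂ, w.im < 0 → Complex.exp (α * Complex.I) * w ∈ Eᶜ := by
    intro w hw hE
    obtain ⟨him, hre⟩ := hK.subNegAxis hE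
    simp only [Complex.mul_re, Complex.mul_im, Complex.exp_ofReal_mul_I_re,
      Complex.exp_ofReal_mul_I_im] at him hre
    have hs := Real.sin_nonneg_of_nonneg_of_le_pi hα0 hαπ
    have h1 := Real.sin_sq_add_cos_sq α
    have h2 : w.im = -(Real.sin α * (Real.cos α * w.re - Real.sin α * w.im)) := by
      linear_combination (-w.im) * h1 + Real.cos α * him
    have h3 := mul_nonpos_of_nonneg_of_nonpos hs hre
    linarith
  have hmain : ∀ ε > 0, G ζ ≤ ε * H ζ := by
    intro ε hε
    obtain ⟨R, hRpow, hR1, hRζ⟩ : ∃ R : ℝ, C / (ε * Real.cos (π / 2 * b)) ≤ R ^ (1 / 20 : ℝ) ∧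
        1 ≤ R ∧ ‖ζ‖ ≤ R :=
      (((tendsto_rpow_atTop (by norm_num : (0 : ℝ) < 1 / 20)).eventually_ge_atTop _).and
        ((eventually_ge_atTop 1).and (eventually_ge_atTop ‖ζ‖))).exists
    have hR0 : 0 < R := by linarith
    set K : Set ℂ := closedBall 0 R ∩ {w | w.im ≤ 0}
    have hKc : IsCompact K := (isCompact_closedBall _ _).inter_right
      (isClosed_le (by fun_prop) (by fun_prop))
    have hcont : ContinuousOn (fun w ↦ G w - ε * H w) K :=
      hGcont.continuousOn.sub (continuousOn_const.mul (hHcont.mono Set.inter_subset_right))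
    refine sub_nonpos.1 (nonpos_of_le_circleAverage hKc hcont ?_ ζ
      ⟨mem_closedBall_zero_iff.2 hRζ, hζ⟩)
    intro w hw hpos
    have hwim : w.im ≤ 0 := hw.2
    have him : w.im < 0 := by
      refine lt_of_le_of_ne hwim fun h0 ↦ ?_
      rw [hreal w h0] at hpos
      nlinarith [mul_nonneg hε.le (hH0 w hwim)]
    have harc : ‖w‖ < R := by
      refine lt_of_le_of_ne (mem_closedBall_zero_iff.1 hw.1) fun heq ↦ ?_
      have h1 : G w ≤ C * R ^ (9 / 10 : ℝ) := by
        have h2 := hgrowth (Complex.exp (↑(-α) * Complex.I) * w) (by rw [hnorm, heq]; exact hR1)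
        rw [hnorm, heq] at h2
        have h3 := hK.nonneg (Complex.exp (α * Complex.I) * w)
        simp only [hG]
        linarith
      have h2 := mul_le_mul_of_nonneg_left (hHge w hwim) hε.le
      rw [heq, show b = 1 / 20 + 9 / 10 by rw [hb]; norm_num, Real.rpow_add hR0,
        ← show b = 1 / 20 + 9 / 10 by rw [hb]; norm_num] at h2
      rw [div_le_iff₀ (by positivity)] at hRpow
      have h3 := mul_le_mul_of_nonneg_right hRpow (by positivity : 0 ≤ R ^ (9 / 10 : ℝ))
      linarith
    have hopen : IsOpen (ball (0 : ℂ) R ∩ {w | w.im < 0}) :=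
      isOpen_ball.inter (isOpen_lt (by fun_prop) (by fun_prop))
    obtain ⟨ρ, hρ, hball⟩ := nhds_basis_closedBall.mem_iff.1
      (hopen.mem_nhds ⟨mem_ball_zero_iff.2 harc, him⟩)
    have hballK : closedBall w ρ ⊆ K := fun x hx ↦
      ⟨ball_subset_closedBall (hball hx).1, le_of_lt (a := x.im) (hball hx).2⟩
    refine ⟨ρ, hρ, hballK, ?_⟩
    have hrot : ∀ (β : ℝ) (x : ℂ), x ∈ closedBall (Complex.exp (β * Complex.I) * w) ρ →
        ∃ y ∈ closedBall w ρ, Complex.exp (β * Complex.I) * y = x := by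
      intro β x hx
      have e : Complex.exp (β * Complex.I) * (Complex.exp (↑(-β) * Complex.I) * x) = x := by
        rw [← mul_assoc, ← Complex.exp_add]
        simp
      refine ⟨Complex.exp (↑(-β) * Complex.I) * x, ?_, e⟩
      rw [mem_closedBall, dist_eq_norm] at hx ⊢
      rwa [← hnorm β, mul_sub, e]
    have hintG : CircleIntegrable G w ρ := hGcont.continuousOn.circleIntegrable hρ.le
    have hintH : CircleIntegrable (fun x ↦ ε * H x) w ρ :=
      (continuousOn_const.mul (hHcont.mono (sphere_subset_closedBall.trans
        (hballK.trans Set.inter_subset_right)))).circleIntegrable hρ.le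
    have hHavg : circleAverage (fun x ↦ ε * H x) w ρ = ε * H w := by
      have h1 := circleAverage_fun_smul (a := ε) (f := H) (c := w) (R := ρ)
      simp only [smul_eq_mul] at h1
      rw [h1, hH, circleAverage_comp_rotation (fun x : ℂ ↦ (x ^ (b : ℂ)).re),
        circleAverage_re_cpow hρ]
      intro x hx
      obtain ⟨y, hy, rfl⟩ := hrot _ x hx
      refine Complex.mem_slitPlane_iff.2 (.inl ?_)
      rw [hIre]
      have : y.im < 0 := (hball hy).2
      linarith
    have hGavg : G w ≤ circleAverage G w ρ := by
      rw [hG, circleAverage_fun_sub ((hcu (-α)).continuousOn.circleIntegrable hρ.le)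
        ((hcu α).continuousOn.circleIntegrable hρ.le), circleAverage_comp_rotation,
        circleAverage_comp_rotation]
      refine sub_le_sub (hK.le_circleAverage _ hρ) (hK.circleAverage_eq hρ fun x hx ↦ ?_).le
      obtain ⟨y, hy, rfl⟩ := hrot _ x hx
      exact hcompl y (hball hy).2
    rw [circleAverage_fun_sub hintG hintH, hHavg]
    linarith
  refine sub_nonpos.1 (?_ : G ζ ≤ 0)
  have hHζ := hH0 ζ hζ
  by_contra! hpos
  have h1 := hmain (G ζ / (H ζ + 1)) (by positivity)
  rw [div_mul_eq_mul_div, le_div_iff₀ (by positivity)] at h1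
  linarith

theorem apply_polar_le (hK : ClassK u E) {r : ℝ} (hr : 0 < r) {θ₁ θ₂ : ℝ} (h₁ : 0 ≤ θ₁)
    (h₁₂ : θ₁ ≤ θ₂) (h₂ : θ₂ ≤ π) :
    u ((r : ℂ) * Complex.exp (θ₂ * Complex.I)) ≤ u ((r : ℂ) * Complex.exp (θ₁ * Complex.I)) := by
  have hζ : ((r : ℂ) * Complex.exp (↑((θ₁ - θ₂) / 2) * Complex.I)).im ≤ 0 := by
    rw [Complex.im_ofReal_mul, Complex.exp_ofReal_mul_I_im]
    exact mul_nonpos_of_nonneg_of_nonpos hr.le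
      (Real.sin_nonpos_of_nonpos_of_neg_pi_le (by linarith) (by linarith))
  have h := hK.rotation_le_rotation (α := (θ₁ + θ₂) / 2) (by linarith) (by linarith) hζ
  rw [mul_left_comm, ← Complex.exp_add, mul_left_comm, ← Complex.exp_add] at h
  rw [← hK.symm ((r : ℂ) * Complex.exp (θ₂ * Complex.I)), map_mul, Complex.conj_ofReal,
    ← Complex.exp_conj, map_mul, Complex.conj_ofReal, Complex.conj_I]
  convert h using 4
  · push_cast
    ring
  · push_cast
    ring

end ClassK

theorem stmt12 (u : ℂ → ℝ) (E : Set ℂ) (hK : ClassK u E) :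
    ∀ r > (0 : ℝ),
      (∀ θ₁ θ₂ : ℝ, 0 ≤ θ₁ → θ₁ ≤ θ₂ → θ₂ ≤ π →
        u ((r : ℂ) * Complex.exp (θ₂ * Complex.I)) ≤
          u ((r : ℂ) * Complex.exp (θ₁ * Complex.I))) ∧
      Bmax u r = u (r : ℂ) ∧ Amin u r = u (-(r : ℂ)) := by
  intro r hr
  have hpolar : ∀ z ∈ sphere (0 : ℂ) r, u z = u ((r : ℂ) * Complex.exp (|z.arg| * Complex.I)) := by
    intro z hz
    have hz' : ((r : ℂ) * Complex.exp (z.arg * Complex.I)) = z := by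
      rw [← mem_sphere_zero_iff_norm.1 hz, Complex.norm_mul_exp_arg_mul_I]
    rcases abs_cases z.arg with ⟨h, -⟩ | ⟨h, -⟩
    · rw [h, hz']
    · rw [h, ← hK.symm z]
      nth_rewrite 1 [← hz']
      rw [map_mul, Complex.conj_ofReal, ← Complex.exp_conj, map_mul, Complex.conj_ofReal,
        Complex.conj_I]
      simp
  refine ⟨fun θ₁ θ₂ h₁ h₁₂ h₂ ↦ hK.apply_polar_le hr h₁ h₁₂ h₂, ?_, ?_⟩
  · refine IsGreatest.csSup_eq ⟨⟨r, by simp [hr.le], rfl⟩, ?_⟩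
    rintro _ ⟨z, hz, rfl⟩
    rw [hpolar z hz]
    simpa using hK.apply_polar_le hr le_rfl (abs_nonneg z.arg) (Complex.abs_arg_le_pi z)
  · refine IsLeast.csInf_eq ⟨⟨-(r : ℂ), by simp [hr.le], rfl⟩, ?_⟩
    rintro _ ⟨z, hz, rfl⟩
    rw [hpolar z hz]
    simpa [Complex.exp_pi_mul_I] using
      hK.apply_polar_le hr (abs_nonneg z.arg) (Complex.abs_arg_le_pi z) le_rfl
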